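/- Let v : ℝ → ℝ be defined by v(x) := (3/2)/cosh²(x/2), where cosh t = (e^t + e^{-t})/2. Then: (1) v(x) > 0 for all x ∈ ℝ and v solves the Newton equation -v''(x) + v(x) - v(x)² = 0 for all x ∈ ℝ; (2) v solves the fourth-order equation v''''(x) - v(x) + W(x)·v(x) = 0 for all x ∈ ℝ, where W(x) := -(10/3)v(x)² + 5v(x). -/

import Mathlib

noncomputable section

/-- The soliton `v(x) = (3/2)/cosh²(x/2)`. -/
def soliton (x : ℝ) : ℝ := (3 / 2) / Real.cosh (x / 2) ^ 2

theorem soliton_pos (x : ℝ) : 0 < soliton x := by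
  have := Real.cosh_pos (x / 2)
  unfold soliton
  positivity

theorem hasDerivAt_soliton (x : ℝ) :
    HasDerivAt soliton (-(soliton x * Real.tanh (x / 2))) x := by
  have hc := (Real.cosh_pos (x / 2)).ne'
  have h := (((hasDerivAt_id x).div_const 2).cosh.pow 2).fun_inv (pow_ne_zero 2 hc)
  refine (h.const_mul (3 / 2)).congr_deriv ?_
  simp only [soliton, Real.tanh_eq_sinh_div_cosh, id, Pi.pow_apply]
  field_simp
  norm_num
  ring

theorem deriv_soliton : deriv soliton = fun x => -(soliton x * Real.tanh (x / 2)) :=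
  funext fun x => (hasDerivAt_soliton x).deriv

theorem sq_tanh_half_eq (x : ℝ) : Real.tanh (x / 2) ^ 2 = 1 - 2 / 3 * soliton x := by
  have hc := (Real.cosh_pos (x / 2)).ne'
  have h := Real.cosh_sq (x / 2)
  rw [soliton, Real.tanh_eq_sinh_div_cosh]
  field_simp
  linarith

theorem hasDerivAt_tanh_half (x : ℝ) :
    HasDerivAt (fun y : ℝ => Real.tanh (y / 2)) (soliton x / 3) x := by
  have hc := (Real.cosh_pos (x / 2)).ne'
  have hx := (hasDerivAt_id x).div_const 2
  have h := hx.sinh.fun_div hx.cosh hc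
  simp only [Real.tanh_eq_sinh_div_cosh]
  refine h.congr_deriv ?_
  have hs := Real.cosh_sq (x / 2)
  simp only [soliton, id]
  field_simp
  linarith

theorem deriv_deriv_soliton : deriv (deriv soliton) = fun x => soliton x - soliton x ^ 2 := by
  rw [deriv_soliton]
  funext x
  rw [((hasDerivAt_soliton x).fun_mul (hasDerivAt_tanh_half x)).fun_neg.deriv]
  linear_combination soliton x * sq_tanh_half_eq x

theorem deriv_deriv_soliton_sub_sq (x : ℝ) :
    deriv (deriv fun y => soliton y - soliton y ^ 2) x =
      soliton x - 5 * soliton x ^ 2 + 10 / 3 * soliton x ^ 3 := by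
  have h : (deriv fun y => soliton y - soliton y ^ 2) =
      fun y => -(soliton y * Real.tanh (y / 2)) * (1 - 2 * soliton y) := by
    funext y
    rw [((hasDerivAt_soliton y).fun_sub ((hasDerivAt_soliton y).fun_pow 2)).deriv]
    norm_num
    ring
  have hv := hasDerivAt_soliton x
  rw [h, ((hv.fun_mul (hasDerivAt_tanh_half x)).fun_neg.fun_mul
    ((hv.const_mul 2).const_sub 1)).deriv]
  linear_combination (soliton x - 4 * soliton x ^ 2) * sq_tanh_half_eq x

/-- The function `v(x) = (3/2)/cosh²(x/2)` is positive, solves the Newton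
equation `-v'' + v - v² = 0` on `ℝ`, and solves the fourth-order equation
`v'''' - v + W·v = 0` with `W = -(10/3)v² + 5v`. -/
theorem soliton_newton_and_fourth_order :
    (∀ x : ℝ, 0 < soliton x) ∧
    (∀ x : ℝ, -deriv (deriv soliton) x + soliton x - soliton x ^ 2 = 0) ∧
    (∀ x : ℝ, iteratedDeriv 4 soliton x - soliton x +
      (-(10 / 3) * soliton x ^ 2 + 5 * soliton x) * soliton x = 0) := by
  refine ⟨soliton_pos, fun x => ?_, fun x => ?_⟩
  · rw [deriv_deriv_soliton]
    ring
  · have h : iteratedDeriv 4 soliton = deriv (deriv (deriv (deriv soliton))) := by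
      simp only [iteratedDeriv_succ, iteratedDeriv_zero]
    rw [h, deriv_deriv_soliton, deriv_deriv_soliton_sub_sq]
    ring
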